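/- Assume m := rank(Bᵀ − B) > 0. Then m is even, every irreducible complex representation of H_β has dimension 1 or q^{m/2}, exactly qⁿ of them (up to isomorphism) have dimension 1, and exactly (q−1)·q^{n−m} of them have dimension q^{m/2}. -/

import Mathlib

open Matrix

/-- The generalized Heisenberg group `H_β` attached to the bilinear form
`β(u,w) = uᵀ B w` on `V = 𝔽ⁿ` with Gram matrix `B`.  Its carrier is `V × 𝔽`;
an element is a pair `⟨v, r⟩` with `v ∈ V` and `r ∈ 𝔽`. -/
@[ext]
structure Hei (𝔽 : Type) [Field 𝔽] (n : ℕ) (B : Matrix (Fin n) (Fin n) 𝔽) where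
  v : Fin n → 𝔽
  t : 𝔽

namespace Hei

variable {𝔽 : Type} [Field 𝔽] {n : ℕ} {B : Matrix (Fin n) (Fin n) 𝔽}

/-- Multiplication `(v,r)·(w,s) = (v+w, r+s+β(v,w))`. -/
instance : Mul (Hei 𝔽 n B) := ⟨fun p q => ⟨p.v + q.v, p.t + q.t + p.v ⬝ᵥ B *ᵥ q.v⟩⟩
instance : One (Hei 𝔽 n B) := ⟨⟨0, 0⟩⟩
instance : Inv (Hei 𝔽 n B) := ⟨fun p => ⟨-p.v, p.v ⬝ᵥ B *ᵥ p.v - p.t⟩⟩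

lemma mul_def (p q : Hei 𝔽 n B) :
    p * q = ⟨p.v + q.v, p.t + q.t + p.v ⬝ᵥ B *ᵥ q.v⟩ := rfl
lemma one_def : (1 : Hei 𝔽 n B) = ⟨0, 0⟩ := rfl
lemma inv_def (p : Hei 𝔽 n B) : p⁻¹ = ⟨-p.v, p.v ⬝ᵥ B *ᵥ p.v - p.t⟩ := rfl

instance : Group (Hei 𝔽 n B) where
  mul := (· * ·)
  one := 1
  inv := (·⁻¹)
  mul_assoc p q r := by
    simp only [mul_def, mk.injEq, mulVec_add, dotProduct_add, add_dotProduct]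
    exact ⟨add_assoc _ _ _, by ring⟩
  one_mul p := by simp [mul_def, one_def]
  mul_one p := by simp [mul_def, one_def]
  inv_mul_cancel p := by
    simp only [mul_def, inv_def, one_def, mk.injEq, neg_dotProduct]
    exact ⟨neg_add_cancel _, by ring⟩

end Hei

open CategoryTheory

section gen
variable {G : Type} [Group G]

lemma Hei_schur (V : FDRep ℂ G) [Simple V] (z : G) (hz : ∀ g, z * g = g * z) :
    ∃ c : ℂ, V.ρ z = c • 1 := by
  let f : V ⟶ V := ⟨Action.ρ V z, fun g => by
    have h : V.ρ z * V.ρ g = V.ρ g * V.ρ z := by rw [← map_mul, hz, map_mul]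
    ext x
    exact LinearMap.congr_fun h x⟩
  obtain ⟨c, hc⟩ := endomorphism_simple_eq_smul_id ℂ f
  refine ⟨c, ?_⟩
  have := congrArg (fun u : V ⟶ V => u.hom.hom.hom) hc
  exact this.symm

lemma Hei_norm [Fintype G] (V : FDRep ℂ G) [hV : Simple V] (S : Finset G)
    (hS : ∀ g ∈ S, ∃ c : ℂ, V.ρ g = c • 1) (hS' : ∀ g ∉ S, V.character g = 0) :
    Module.finrank ℂ V ^ 2 * S.card = Nat.card G := by
  have h := (FDRep.simple_iff_char_is_norm_one V).1 hV
  have h2 : ∑ g : G, V.character g * V.character g⁻¹ =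
      ∑ g ∈ S, V.character g * V.character g⁻¹ := by
    symm
    apply Finset.sum_subset (Finset.subset_univ _)
    intro g _ hg
    rw [hS' g hg, zero_mul]
  have h3 : ∀ g ∈ S, V.character g * V.character g⁻¹ = (Module.finrank ℂ V : ℂ) ^ 2 := by
    intro g hg
    obtain ⟨c, hc⟩ := hS g hg
    have e1 : V.character g = c * Module.finrank ℂ V := by
      simp only [FDRep.character, hc, map_smul, LinearMap.trace_one, smul_eq_mul]
    have e2 : c * V.character g⁻¹ = Module.finrank ℂ V := by
      have : V.ρ g * V.ρ g⁻¹ = 1 := by rw [← map_mul, mul_inv_cancel, map_one]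
      rw [hc, smul_mul_assoc, one_mul] at this
      simp only [FDRep.character]
      rw [← smul_eq_mul, ← map_smul, this, LinearMap.trace_one]
    rw [e1, mul_right_comm, e2, sq]
  rw [h2, Finset.sum_congr rfl h3, Finset.sum_const, nsmul_eq_mul] at h
  have : ((Module.finrank ℂ V ^ 2 * S.card : ℕ) : ℂ) = (Nat.card G : ℕ) := by
    rw [← h]; push_cast; ring
  exact_mod_cast this

lemma Hei_finrank_pos (V : FDRep ℂ G) [hV : Simple V] : 0 < Module.finrank ℂ V := by
  rw [Nat.pos_iff_ne_zero]
  intro h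
  have := Module.finrank_zero_iff.1 h
  apply id_nonzero V
  ext x
  exact Subsingleton.elim (α := V) _ _

lemma Hei_exists_simple (d : ℕ) : ∀ V : FDRep ℂ G, Module.finrank ℂ V = d → 0 < d →
    ∃ W : FDRep ℂ G, Simple W ∧ ∀ (g : G) (c : ℂ), V.ρ g = c • 1 → W.ρ g = c • 1 := by
  induction d using Nat.strong_induction_on with
  | _ d ih =>
    intro V hd hpos
    by_cases hV : Simple V
    · exact ⟨V, hV, fun _ _ h => h⟩
    have hid : 𝟙 V ≠ 0 := by
      intro h0
      have : Subsingleton V := by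
        refine ⟨fun x y => ?_⟩
        have h1 : ∀ x : V, x = 0 := fun x =>
          LinearMap.congr_fun (congrArg (fun u : V ⟶ V => u.hom.hom.hom) h0) x
        rw [h1 x, h1 y]
      rw [Module.finrank_zero_of_subsingleton] at hd
      omega
    have : ∃ (Y : FDRep ℂ G) (f : Y ⟶ V), Mono f ∧ f ≠ 0 ∧ ¬ IsIso f := by
      by_contra! hcon
      apply hV
      refine ⟨fun {Y} f hf => ⟨fun hi h0 => ?_, fun h0 => hcon Y f hf h0⟩⟩
      apply hid
      have h1 := IsIso.inv_hom_id f
      rw [← h1]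
      have : CategoryTheory.inv f ≫ f = CategoryTheory.inv f ≫ 0 := congrArg _ h0
      rw [this, Limits.comp_zero]
    obtain ⟨Y, f, hf, hf0, hfi⟩ := this
    let F : Y →ₗ[ℂ] V := f.hom.hom.hom
    have hcomm : ∀ g y, F (Y.ρ g y) = V.ρ g (F y) := by
      intro g y
      exact LinearMap.congr_fun (congrArg (fun u => u.hom.hom) (f.comm g)) y
    have hinj : Function.Injective F := by
      have : Mono ((forget₂ (FDRep ℂ G) (Rep ℂ G)).map f) := inferInstance
      exact (Rep.mono_iff_injective _).1 this
    have hlt : Module.finrank ℂ Y < d := by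
      rw [← hd]
      refine lt_of_le_of_ne (LinearMap.finrank_le_finrank_of_injective hinj) fun he => hfi ?_
      have hsurj : Function.Surjective F :=
        (LinearMap.injective_iff_surjective_of_finrank_eq_finrank he).1 hinj
      have : Epi f := ConcreteCategory.epi_of_surjective f hsurj
      exact isIso_of_mono_of_epi f
    have hYpos : 0 < Module.finrank ℂ Y := by
      rw [Nat.pos_iff_ne_zero]
      intro h
      have := Module.finrank_zero_iff.1 h
      apply hf0
      ext x
      have hx : x = 0 := Subsingleton.elim (α := Y) _ _
      rw [hx]
      exact F.map_zero
    obtain ⟨W, hW, hWc⟩ := ih _ hlt Y rfl hYpos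
    refine ⟨W, hW, fun g c hg => hWc g c ?_⟩
    ext y
    apply hinj
    rw [hcomm, hg]
    simp

end gen

lemma Hei_even {𝔽 : Type} [Field 𝔽] (h2 : (2 : 𝔽) ≠ 0) {n : ℕ} (A : Matrix (Fin n) (Fin n) 𝔽)
    (hA : Aᵀ = -A) : Even A.rank := by
  obtain ⟨W, hW⟩ := Submodule.exists_isCompl (LinearMap.ker A.mulVecLin)
  have hWr : Module.finrank 𝔽 W = A.rank := by
    have h1 := Submodule.finrank_add_eq_of_isCompl hW
    have h2 := LinearMap.finrank_range_add_finrank_ker A.mulVecLin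
    rw [Matrix.rank]; omega
  have hskew : ∀ u w, u ⬝ᵥ A *ᵥ w = - (w ⬝ᵥ A *ᵥ u) := by
    intro u w
    rw [dotProduct_mulVec, dotProduct_comm, ← mulVec_transpose, hA, neg_mulVec, dotProduct_neg]
  let b := Module.finBasisOfFinrankEq 𝔽 W hWr
  let C : Matrix (Fin A.rank) (Fin A.rank) 𝔽 := Matrix.of fun i j =>
    (b i : Fin n → 𝔽) ⬝ᵥ A *ᵥ (b j : Fin n → 𝔽)
  have hC : Cᵀ = -C := by
    ext i j
    simp only [C, Matrix.transpose_apply, Matrix.of_apply, Matrix.neg_apply]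
    exact hskew _ _
  have hdet : C.det ≠ 0 := by
    intro h0
    obtain ⟨x, hx, hCx⟩ := Matrix.exists_mulVec_eq_zero_iff.2 h0
    let w : W := ∑ j, x j • b j
    have hw : (w : Fin n → 𝔽) = ∑ j, x j • (b j : Fin n → 𝔽) := by simp [w]
    have hbw : ∀ i, (b i : Fin n → 𝔽) ⬝ᵥ A *ᵥ (w : Fin n → 𝔽) = 0 := by
      intro i
      have := congrFun hCx i
      simp only [mulVec, dotProduct, C, Matrix.of_apply, Pi.zero_apply] at this
      rw [hw, mulVec_sum, dotProduct_sum, ← this]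
      refine Finset.sum_congr rfl fun j _ => ?_
      rw [mulVec_smul, dotProduct_smul, smul_eq_mul, mul_comm]
      rfl
    have hWw : ∀ u : W, (u : Fin n → 𝔽) ⬝ᵥ A *ᵥ (w : Fin n → 𝔽) = 0 := by
      intro u
      have hu : (u : Fin n → 𝔽) = ∑ j, b.repr u j • (b j : Fin n → 𝔽) := by
        conv_lhs => rw [← b.sum_repr u]
        simp only [Submodule.coe_sum, Submodule.coe_smul]
      rw [hu, sum_dotProduct]
      simp only [smul_dotProduct, hbw, smul_zero, Finset.sum_const_zero]
    have hall : ∀ u : Fin n → 𝔽, u ⬝ᵥ A *ᵥ (w : Fin n → 𝔽) = 0 := by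
      intro u
      have hu : u ∈ LinearMap.ker A.mulVecLin ⊔ W := by rw [hW.sup_eq_top]; trivial
      obtain ⟨r, hr, y, hy, rfl⟩ := Submodule.mem_sup.1 hu
      have hr' : A *ᵥ r = 0 := by simpa using hr
      rw [add_dotProduct, hWw ⟨y, hy⟩, hskew, hr']
      simp
    have hAw : A *ᵥ (w : Fin n → 𝔽) = 0 := dotProduct_eq_zero _ fun u => by rw [dotProduct_comm]; exact hall u
    have hw0 : (w : Fin n → 𝔽) ∈ LinearMap.ker A.mulVecLin ⊓ W := ⟨by simpa using hAw, w.2⟩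
    rw [hW.inf_eq_bot, Submodule.mem_bot] at hw0
    have hw0' : w = 0 := Subtype.ext hw0
    apply hx
    funext j
    exact (Fintype.linearIndependent_iff.1 b.linearIndependent) x hw0' j
  by_contra hodd
  rw [Nat.not_even_iff_odd] at hodd
  have := Matrix.det_transpose C
  rw [hC, Matrix.det_neg, Fintype.card_fin, hodd.neg_one_pow] at this
  apply hdet
  have h3 : (2 : 𝔽) * C.det = 0 := by linear_combination -this
  exact (mul_eq_zero.1 h3).resolve_left h2

namespace Hei
variable {𝔽 : Type} [Field 𝔽] {n : ℕ} {B : Matrix (Fin n) (Fin n) 𝔽}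

/-- The underlying set is `V × 𝔽`. -/
def equivProd : Hei 𝔽 n B ≃ (Fin n → 𝔽) × 𝔽 where
  toFun g := (g.v, g.t)
  invFun x := ⟨x.1, x.2⟩
  left_inv _ := rfl
  right_inv _ := rfl

/-- The radical of the alternating form. -/
abbrev rad (B : Matrix (Fin n) (Fin n) 𝔽) : Submodule 𝔽 (Fin n → 𝔽) :=
  LinearMap.ker (Bᵀ - B).mulVecLin

lemma mem_rad {v : Fin n → 𝔽} : v ∈ rad B ↔ (Bᵀ - B) *ᵥ v = 0 := Iff.rfl

lemma form_swap (v w : Fin n → 𝔽) :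
    v ⬝ᵥ B *ᵥ w = w ⬝ᵥ B *ᵥ v + w ⬝ᵥ (Bᵀ - B) *ᵥ v := by
  rw [sub_mulVec, dotProduct_sub, mulVec_transpose, ← dotProduct_comm (v ᵥ* B) w,
    ← dotProduct_mulVec]
  ring

lemma form_symm {v : Fin n → 𝔽} (hv : v ∈ rad B) (w : Fin n → 𝔽) :
    v ⬝ᵥ B *ᵥ w = w ⬝ᵥ B *ᵥ v := by
  rw [form_swap, mem_rad.1 hv, dotProduct_zero, add_zero]

lemma central {z : Hei 𝔽 n B} (hz : z.v ∈ rad B) (g : Hei 𝔽 n B) : z * g = g * z := by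
  rw [mul_def, mul_def, form_symm hz, add_comm z.v, add_comm z.t]

lemma comm_eq (g h : Hei 𝔽 n B) :
    g * h = ⟨0, h.v ⬝ᵥ (Bᵀ - B) *ᵥ g.v⟩ * (h * g) := by
  simp only [mul_def, mk.injEq, zero_add, zero_dotProduct, add_zero]
  exact ⟨add_comm _ _, by rw [form_swap g.v h.v]; ring⟩

lemma exists_form {v : Fin n → 𝔽} (hv : v ∉ rad B) (s : 𝔽) :
    ∃ w, w ⬝ᵥ (Bᵀ - B) *ᵥ v = s := by
  rw [mem_rad] at hv
  obtain ⟨i, hi⟩ := Function.ne_iff.1 hv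
  refine ⟨Pi.single i (s / ((Bᵀ - B) *ᵥ v) i), ?_⟩
  rw [single_dotProduct, div_mul_cancel₀]
  exact hi

lemma exists_not_mem_rad (h : 0 < (Bᵀ - B).rank) : ∃ v, v ∉ rad B := by
  by_contra! hcon
  have : Bᵀ - B = 0 := by
    ext i j
    have := congrFun (mem_rad.1 (hcon (Pi.single j 1))) i
    simpa using this
  rw [this, Matrix.rank_zero] at h
  exact lt_irrefl _ h

lemma one_eq : (1 : Hei 𝔽 n B) = ⟨0, 0⟩ := rfl

lemma zmul (s t : 𝔽) : (⟨0, s⟩ * ⟨0, t⟩ : Hei 𝔽 n B) = ⟨0, s + t⟩ := by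
  simp [mul_def]

variable [Fintype 𝔽]

noncomputable instance : Fintype (Hei 𝔽 n B) := Fintype.ofEquiv _ equivProd.symm

lemma card_hei : Nat.card (Hei 𝔽 n B) = Fintype.card 𝔽 ^ n * Fintype.card 𝔽 := by
  rw [Nat.card_congr equivProd, Nat.card_eq_fintype_card]
  simp

lemma card_rad : Nat.card (rad B) = Fintype.card 𝔽 ^ (n - (Bᵀ - B).rank) := by
  rw [Module.natCard_eq_pow_finrank (K := 𝔽), Nat.card_eq_fintype_card]
  congr 1
  have := LinearMap.finrank_range_add_finrank_ker (Bᵀ - B).mulVecLin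
  rw [Module.finrank_fin_fun] at this
  rw [Matrix.rank]
  change _ + Module.finrank 𝔽 (rad B) = _ at this
  omega

lemma rank_le : (Bᵀ - B).rank ≤ n := by
  simpa using (Bᵀ - B).rank_le_width

open Classical in
/-- The centre, as a finite set. -/
noncomputable def cen (B : Matrix (Fin n) (Fin n) 𝔽) : Finset (Hei 𝔽 n B) :=
  Finset.univ.filter fun g => g.v ∈ rad B

lemma mem_cen {g : Hei 𝔽 n B} : g ∈ cen B ↔ g.v ∈ rad B := by simp [cen]

lemma card_cen :
    (cen B).card = Fintype.card 𝔽 ^ (n - (Bᵀ - B).rank) * Fintype.card 𝔽 := by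
  rw [← card_rad, ← Nat.card_eq_fintype_card, ← Nat.card_prod, ← Nat.card_eq_finsetCard (cen B)]
  refine Nat.card_congr ⟨fun g => (⟨g.1.v, mem_cen.1 g.2⟩, g.1.t),
    fun x => ⟨⟨x.1, x.2⟩, mem_cen.2 x.1.2⟩, fun _ => rfl, fun _ => rfl⟩

lemma finrank_one_of_trivial (V : FDRep ℂ (Hei 𝔽 n B)) [Simple V]
    (h : ∀ t, V.ρ ⟨0, t⟩ = 1) : Module.finrank ℂ V = 1 := by
  have hc : ∀ g h, V.ρ g * V.ρ h = V.ρ h * V.ρ g := by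
    intro g k
    rw [← map_mul, comm_eq, map_mul, h, one_mul, map_mul]
  have hs : ∀ g, ∃ c : ℂ, V.ρ g = c • 1 := by
    intro g
    let f : V ⟶ V := ⟨Action.ρ V g, fun k => by
      ext x
      exact LinearMap.congr_fun (hc g k) x⟩
    obtain ⟨c, hc⟩ := endomorphism_simple_eq_smul_id ℂ f
    refine ⟨c, ?_⟩
    have := congrArg (fun u : V ⟶ V => u.hom.hom.hom) hc
    exact this.symm
  have := Hei_norm V Finset.univ (fun g _ => hs g) (fun g hg => absurd (Finset.mem_univ g) hg)
  rw [Finset.card_univ, Nat.card_eq_fintype_card] at this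
  have h0 : 0 < Fintype.card (Hei 𝔽 n B) := Fintype.card_pos
  have h1 : Module.finrank ℂ V ^ 2 = 1 := by
    apply Nat.eq_of_mul_eq_mul_right h0
    rw [this, one_mul]
  exact (Nat.pow_eq_one.1 h1).resolve_right two_ne_zero

lemma trivial_of_finrank_one (hr : 0 < (Bᵀ - B).rank) (V : FDRep ℂ (Hei 𝔽 n B))
    (h : Module.finrank ℂ V = 1) (t : 𝔽) : V.ρ ⟨0, t⟩ = 1 := by
  obtain ⟨v, hv⟩ := exists_not_mem_rad hr
  obtain ⟨w, hw⟩ := exists_form hv t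
  have hs : ∀ f : V →ₗ[ℂ] V, ∃ c : ℂ, f = c • 1 := by
    intro f
    obtain ⟨x, hx, hx'⟩ := finrank_eq_one_iff'.1 h
    obtain ⟨c, hc⟩ := hx' (f x)
    refine ⟨c, LinearMap.ext fun y => ?_⟩
    obtain ⟨d, rfl⟩ := hx' y
    simp [← hc, smul_comm c d]
  have hc := congrArg V.ρ (comm_eq (⟨v, 0⟩ : Hei 𝔽 n B) ⟨w, 0⟩)
  simp only [hw, map_mul] at hc
  have hinv : ∀ g, V.ρ g * V.ρ g⁻¹ = 1 := fun g => by rw [← map_mul, mul_inv_cancel, map_one]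
  obtain ⟨c, hcc⟩ := hs (V.ρ (⟨v, 0⟩ : Hei 𝔽 n B))
  have e : V.ρ (⟨v, 0⟩ : Hei 𝔽 n B) * V.ρ (⟨w, 0⟩ : Hei 𝔽 n B) =
      V.ρ (⟨w, 0⟩ : Hei 𝔽 n B) * V.ρ (⟨v, 0⟩ : Hei 𝔽 n B) := by
    rw [hcc]; simp
  rw [e, ← map_mul V.ρ (⟨w, 0⟩ : Hei 𝔽 n B)] at hc
  have := congrArg (· * V.ρ ((⟨w, 0⟩ : Hei 𝔽 n B) * ⟨v, 0⟩)⁻¹) hc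
  simp only [mul_assoc, hinv, mul_one] at this
  exact this.symm

lemma char_zero_of_nontrivial (V : FDRep ℂ (Hei 𝔽 n B)) [Simple V]
    {t : 𝔽} (h : V.ρ ⟨0, t⟩ ≠ 1) (g : Hei 𝔽 n B) (hg : g.v ∉ rad B) : V.character g = 0 := by
  obtain ⟨w, hw⟩ := exists_form hg t
  have hz : (⟨0, t⟩ : Hei 𝔽 n B).v ∈ rad B := (rad B).zero_mem
  obtain ⟨c, hc⟩ := Hei_schur V ⟨0, t⟩ (central hz)
  have hc1 : c ≠ 1 := fun h1 => h (by rw [hc, h1, one_smul])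
  have e := comm_eq g ⟨w, 0⟩
  simp only [hw] at e
  have e2 : (⟨w, 0⟩ : Hei 𝔽 n B)⁻¹ * (g * ⟨w, 0⟩) = ⟨0, t⟩ * g := by
    rw [e, ← mul_assoc, ← central hz, mul_assoc, inv_mul_cancel_left]
  have e3 : V.character g = c * V.character g := by
    calc V.character g = V.character ((⟨w, 0⟩ : Hei 𝔽 n B)⁻¹ * (g * ⟨w, 0⟩)) := by
          rw [FDRep.char_mul_comm, mul_assoc, mul_inv_cancel, mul_one]
      _ = V.character (⟨0, t⟩ * g) := by rw [e2]
      _ = c * V.character g := by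
          simp only [FDRep.character, map_mul, hc, smul_mul_assoc, one_mul, map_smul, smul_eq_mul]
  have : (c - 1) * V.character g = 0 := by linear_combination -e3
  exact (mul_eq_zero.1 this).resolve_left (sub_ne_zero.2 hc1)

lemma finrank_of_nontrivial (hev : Even (Bᵀ - B).rank) (V : FDRep ℂ (Hei 𝔽 n B)) [Simple V]
    {t : 𝔽} (h : V.ρ ⟨0, t⟩ ≠ 1) :
    Module.finrank ℂ V = Fintype.card 𝔽 ^ ((Bᵀ - B).rank / 2) := by
  have h1 := Hei_norm V (cen B) (fun g hg => Hei_schur V g (central (mem_cen.1 hg)))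
    (fun g hg => char_zero_of_nontrivial V h g (fun h' => hg (mem_cen.2 h')))
  rw [card_cen, card_hei, ← mul_assoc] at h1
  have hq : 0 < Fintype.card 𝔽 := Fintype.card_pos
  have h2 := Nat.eq_of_mul_eq_mul_right hq h1
  obtain ⟨l, hl⟩ := hev
  have hle := rank_le (B := B)
  have h3 : Fintype.card 𝔽 ^ n =
      (Fintype.card 𝔽 ^ l) ^ 2 * Fintype.card 𝔽 ^ (n - (Bᵀ - B).rank) := by
    rw [← pow_mul, ← pow_add]; congr 1; omega
  rw [h3] at h2
  have h4 := Nat.eq_of_mul_eq_mul_right (pow_pos hq _) h2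
  have h5 := Nat.pow_left_injective two_ne_zero h4
  rw [h5]; congr 1; omega

/-- the one-dimensional representation of an additive character -/
noncomputable def rep1 (B : Matrix (Fin n) (Fin n) 𝔽) (ψ : AddChar (Fin n → 𝔽) ℂ) :
    Representation ℂ (Hei 𝔽 n B) ℂ where
  toFun g := ψ g.v • 1
  map_one' := by simp [one_def]
  map_mul' g h := by
    simp only [mul_def, AddChar.map_add_eq_mul, mul_smul, smul_mul_assoc, one_mul]

lemma rep1_char (ψ : AddChar (Fin n → 𝔽) ℂ) (g : Hei 𝔽 n B) :
    (FDRep.of (rep1 B ψ)).character g = ψ g.v := by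
  have : (FDRep.of (rep1 B ψ)).ρ g = (ψ g.v • 1 : ℂ →ₗ[ℂ] ℂ) := rfl
  rw [FDRep.character, this]
  change LinearMap.trace ℂ ℂ (ψ g.v • 1 : ℂ →ₗ[ℂ] ℂ) = _
  rw [map_smul, LinearMap.trace_one]
  simp

lemma rep1_simple (ψ : AddChar (Fin n → 𝔽) ℂ) : Simple (FDRep.of (rep1 B ψ)) := by
  rw [FDRep.simple_iff_char_is_norm_one]
  have : ∀ g : Hei 𝔽 n B, ψ g.v * ψ g⁻¹.v = 1 := by
    intro g
    rw [← AddChar.map_add_eq_mul, inv_def]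
    simp
  simp [rep1_char, this]

lemma count_one (hr : 0 < (Bᵀ - B).rank) :
    Nat.card {f : Hei 𝔽 n B → ℂ //
        ∃ V : FDRep ℂ (Hei 𝔽 n B), Simple V ∧ Module.finrank ℂ V = 1 ∧
          f = V.character} = Fintype.card 𝔽 ^ n := by
  have : Nat.card (AddChar (Fin n → 𝔽) ℂ) = Fintype.card 𝔽 ^ n := by
    classical
    rw [Nat.card_eq_fintype_card, AddChar.card_eq]; simp
  rw [← this]
  symm
  refine Nat.card_congr (Equiv.ofBijective
    (fun ψ => ⟨fun g => ψ g.v, FDRep.of (rep1 B ψ), rep1_simple ψ, ?_, ?_⟩) ⟨?_, ?_⟩)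
  · exact Module.finrank_self ℂ
  · funext g; rw [rep1_char]
  · intro ψ φ h
    ext v
    exact congrFun (congrArg Subtype.val h) ⟨v, 0⟩
  · rintro ⟨f, V, hV, h1, rfl⟩
    have htr := trivial_of_finrank_one hr V h1
    have hs : ∀ g, V.ρ g = V.character g • 1 := by
      intro g
      obtain ⟨x, hx, hx'⟩ := finrank_eq_one_iff'.1 h1
      obtain ⟨c, hc⟩ := hx' (V.ρ g x)
      have : V.ρ g = c • 1 := by
        refine LinearMap.ext fun y => ?_
        obtain ⟨d, rfl⟩ := hx' y
        simp [← hc, smul_comm c d]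
      have h2 : V.character g = c := by
        simp only [FDRep.character, this, map_smul, LinearMap.trace_one, smul_eq_mul, h1]
        simp
      rw [h2, this]
    have hone : V.character 1 = 1 := by rw [FDRep.char_one, h1]; simp
    have hmul : ∀ g h, V.character (g * h) = V.character g * V.character h := by
      intro g h
      conv_lhs => rw [FDRep.character, map_mul, hs g, smul_mul_assoc, one_mul, map_smul]
      rfl
    have ht : ∀ v t, V.character ⟨v, t⟩ = V.character ⟨v, 0⟩ := by
      intro v t
      have : (⟨v, t⟩ : Hei 𝔽 n B) = ⟨0, t⟩ * ⟨v, 0⟩ := by simp [mul_def]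
      rw [this, FDRep.character, map_mul, htr, one_mul]
      rfl
    refine ⟨⟨fun v => V.character ⟨v, 0⟩, hone, fun v w => ?_⟩, ?_⟩
    · rw [← hmul, mul_def]
      exact (ht (v + w) _).symm
    · apply Subtype.ext
      funext g
      exact (ht g.v g.t).symm

open Classical in
/-- Extension by zero of a central character. -/
noncomputable def chi (B : Matrix (Fin n) (Fin n) 𝔽) (ψ : AddChar 𝔽 ℂ) (θ : AddChar (rad B) ℂ)
    (g : Hei 𝔽 n B) : ℂ :=
  if h : g.v ∈ rad B then θ ⟨g.v, h⟩ * ψ (g.t - (g.v ⬝ᵥ B *ᵥ g.v) / 2) else 0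

variable (ψ : AddChar 𝔽 ℂ) (θ : AddChar (rad B) ℂ)

lemma chi_one : chi B ψ θ 1 = 1 := by
  have h : (1 : Hei 𝔽 n B).v ∈ rad B := (rad B).zero_mem
  rw [chi, dif_pos h]
  have : (⟨(1 : Hei 𝔽 n B).v, h⟩ : rad B) = 0 := rfl
  rw [this]
  simp [one_def]

lemma chi_mul (h2 : (2 : 𝔽) ≠ 0) (z g : Hei 𝔽 n B) (hz : z.v ∈ rad B) :
    chi B ψ θ (z * g) = chi B ψ θ z * chi B ψ θ g := by
  by_cases hg : g.v ∈ rad B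
  · have hzg : (z * g).v ∈ rad B := (rad B).add_mem hz hg
    rw [chi, chi, chi, dif_pos hz, dif_pos hg, dif_pos hzg]
    have e1 : (⟨(z * g).v, hzg⟩ : rad B) = ⟨z.v, hz⟩ + ⟨g.v, hg⟩ := rfl
    have e2 : (z * g).t - ((z * g).v ⬝ᵥ B *ᵥ (z * g).v) / 2 =
        (z.t - (z.v ⬝ᵥ B *ᵥ z.v) / 2) + (g.t - (g.v ⬝ᵥ B *ᵥ g.v) / 2) := by
      simp only [mul_def, mulVec_add, dotProduct_add, add_dotProduct]
      rw [form_symm hz g.v]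
      field_simp
      ring
    rw [e1, e2, AddChar.map_add_eq_mul, AddChar.map_add_eq_mul]
    ring
  · have hzg : (z * g).v ∉ rad B := fun h => hg (by
      have := (rad B).sub_mem h hz
      simpa [mul_def] using this)
    rw [chi, dif_neg hzg]
    have : chi B ψ θ g = 0 := by rw [chi, dif_neg hg]
    rw [this, mul_zero]

/-- The induced space. -/
def indSp : Submodule ℂ (Hei 𝔽 n B → ℂ) where
  carrier := {f | ∀ z, z.v ∈ rad B → ∀ g, f (z * g) = chi B ψ θ z * f g}
  add_mem' {a b} ha hb z hz g := by
    simp only [Pi.add_apply, ha z hz g, hb z hz g]; ring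
  zero_mem' z hz g := by simp
  smul_mem' c a ha z hz g := by
    simp only [Pi.smul_apply, ha z hz g, smul_eq_mul]; ring

/-- The induced representation. -/
noncomputable def indRep : Representation ℂ (Hei 𝔽 n B) (indSp ψ θ) where
  toFun h :=
    { toFun := fun f => ⟨fun g => f.1 (g * h), fun z hz g => by
        change f.1 (z * g * h) = _ * f.1 (g * h)
        rw [mul_assoc]; exact f.2 z hz _⟩
      map_add' := fun _ _ => rfl
      map_smul' := fun _ _ => rfl }
  map_one' := by
    ext f g
    simp
  map_mul' h k := by
    ext f g
    simp [mul_assoc]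

lemma indRep_central (z : Hei 𝔽 n B) (hz : z.v ∈ rad B) :
    indRep ψ θ z = chi B ψ θ z • 1 := by
  ext f g
  change f.1 (g * z) = chi B ψ θ z * f.1 g
  rw [← central hz, f.2 z hz]

lemma indSp_pos (h2 : (2 : 𝔽) ≠ 0) : 0 < Module.finrank ℂ (indSp ψ θ) := by
  rw [Module.finrank_pos_iff_exists_ne_zero]
  refine ⟨⟨chi B ψ θ, fun z hz g => chi_mul ψ θ h2 z g hz⟩, fun h => ?_⟩
  have : chi B ψ θ 1 = 0 := congrFun (congrArg Subtype.val h) 1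
  rw [chi_one] at this
  exact one_ne_zero this

lemma char_central (V : FDRep ℂ (Hei 𝔽 n B)) {g : Hei 𝔽 n B} {c : ℂ} (h : V.ρ g = c • 1) :
    V.character g = Module.finrank ℂ V * c := by
  simp only [FDRep.character, h, map_smul, LinearMap.trace_one, smul_eq_mul, mul_comm]

lemma chi_inj (h2 : (2 : 𝔽) ≠ 0) {ψ ψ' : AddChar 𝔽 ℂ} {θ θ' : AddChar (rad B) ℂ}
    (h : chi B ψ θ = chi B ψ' θ') : ψ = ψ' ∧ θ = θ' := by
  constructor
  · ext t
    have := congrFun h ⟨0, t⟩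
    have h0 : (⟨0, t⟩ : Hei 𝔽 n B).v ∈ rad B := (rad B).zero_mem
    rw [chi, chi, dif_pos h0, dif_pos h0] at this
    have e : (⟨(⟨0, t⟩ : Hei 𝔽 n B).v, h0⟩ : rad B) = 0 := rfl
    rw [e] at this
    simpa using this
  · ext v
    have := congrFun h ⟨v, ((v : Fin n → 𝔽) ⬝ᵥ B *ᵥ (v : Fin n → 𝔽)) / 2⟩
    simpa [chi] using this

lemma exists_rep (h2 : (2 : 𝔽) ≠ 0) (hev : Even (Bᵀ - B).rank) (hψ : ψ ≠ 1) :
    ∃ V : FDRep ℂ (Hei 𝔽 n B), Simple V ∧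
      Module.finrank ℂ V = Fintype.card 𝔽 ^ ((Bᵀ - B).rank / 2) ∧
      (fun g => (Fintype.card 𝔽 ^ ((Bᵀ - B).rank / 2) : ℕ) * chi B ψ θ g) = V.character := by
  obtain ⟨V, hV, hVc⟩ := Hei_exists_simple _ (FDRep.of (indRep ψ θ)) rfl (indSp_pos ψ θ h2)
  have hc : ∀ z : Hei 𝔽 n B, z.v ∈ rad B → V.ρ z = chi B ψ θ z • 1 := fun z hz =>
    hVc z _ (indRep_central ψ θ z hz)
  obtain ⟨t, ht⟩ := (AddChar.ne_one_iff).1 hψ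
  have h0 : (⟨0, t⟩ : Hei 𝔽 n B).v ∈ rad B := (rad B).zero_mem
  have hchi : chi B ψ θ ⟨0, t⟩ = ψ t := by
    rw [chi, dif_pos h0]
    have e : (⟨(⟨0, t⟩ : Hei 𝔽 n B).v, h0⟩ : rad B) = 0 := rfl
    rw [e]
    simp
  have hpos := Hei_finrank_pos V
  have hne : V.ρ ⟨0, t⟩ ≠ 1 := by
    rw [hc _ h0, hchi]
    intro h
    apply ht
    have h3 := congrArg (LinearMap.trace ℂ V) h
    rw [map_smul, LinearMap.trace_one, smul_eq_mul] at h3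
    have : (Module.finrank ℂ V : ℂ) ≠ 0 := by exact_mod_cast hpos.ne'
    exact mul_right_cancel₀ this (by rw [h3, one_mul])
  have hfr := finrank_of_nontrivial hev V hne
  refine ⟨V, hV, hfr, ?_⟩
  funext g
  by_cases hg : g.v ∈ rad B
  · rw [char_central V (hc g hg), hfr]
  · rw [char_zero_of_nontrivial V hne g hg, chi, dif_neg hg, mul_zero]

lemma exists_chi (h2 : (2 : 𝔽) ≠ 0) (V : FDRep ℂ (Hei 𝔽 n B)) [Simple V]
    (h1 : Module.finrank ℂ V ≠ 1) :
    ∃ ψ : AddChar 𝔽 ℂ, ψ ≠ 1 ∧ ∃ θ : AddChar (rad B) ℂ,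
      (fun g => Module.finrank ℂ V * chi B ψ θ g) = V.character := by
  have hpos := Hei_finrank_pos V
  have hpos' : (Module.finrank ℂ V : ℂ) ≠ 0 := by exact_mod_cast hpos.ne'
  let c : Hei 𝔽 n B → ℂ := fun g => V.character g / Module.finrank ℂ V
  have hc : ∀ z : Hei 𝔽 n B, z.v ∈ rad B → V.ρ z = c z • 1 := by
    intro z hz
    obtain ⟨d, hd⟩ := Hei_schur V z (central hz)
    have : c z = d := by
      simp only [c, char_central V hd]
      field_simp
    rw [this, hd]
  have hc1 : c 1 = 1 := by
    simp only [c, FDRep.char_one]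
    field_simp
  have hcm : ∀ z g : Hei 𝔽 n B, z.v ∈ rad B → c (z * g) = c z * c g := by
    intro z g hz
    have : V.character (z * g) = c z * V.character g := by
      simp only [FDRep.character, map_mul, hc z hz, smul_mul_assoc, one_mul, map_smul, smul_eq_mul]
    change V.character (z * g) / _ = c z * (V.character g / _)
    rw [this, mul_div_assoc]
  have hex : ∃ t, V.ρ ⟨0, t⟩ ≠ 1 := by
    by_contra! hcon
    exact h1 (finrank_one_of_trivial V hcon)
  obtain ⟨t, ht⟩ := hex
  have h0 : ∀ t, (⟨0, t⟩ : Hei 𝔽 n B).v ∈ rad B := fun _ => (rad B).zero_mem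
  refine ⟨⟨fun t => c ⟨0, t⟩, hc1, fun s t => ?_⟩, ?_,
    ⟨fun v => c ⟨v, ((v : Fin n → 𝔽) ⬝ᵥ B *ᵥ (v : Fin n → 𝔽)) / 2⟩, ?_, ?_⟩, ?_⟩
  · rw [← hcm _ _ (h0 s), zmul]
  · intro h
    apply ht
    rw [hc _ (h0 t)]
    have : c ⟨0, t⟩ = 1 := DFunLike.congr_fun h t
    rw [this, one_smul]
  · simp only [Submodule.coe_zero, zero_dotProduct, zero_div]
    exact hc1
  · intro v w
    rw [← hcm _ _ v.2, mul_def]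
    congr 2
    simp only [Submodule.coe_add, mulVec_add, dotProduct_add, add_dotProduct]
    rw [form_symm v.2 w]
    field_simp
    ring
  · funext g
    by_cases hg : g.v ∈ rad B
    · rw [char_central V (hc g hg), chi, dif_pos hg]
      congr 1
      change c ⟨g.v, (g.v ⬝ᵥ B *ᵥ g.v) / 2⟩ * c ⟨0, g.t - (g.v ⬝ᵥ B *ᵥ g.v) / 2⟩ = c g
      rw [← hcm ⟨g.v, (g.v ⬝ᵥ B *ᵥ g.v) / 2⟩ _ hg, mul_def]
      congr 1
      ext
      · simp
      · simp
    · rw [char_zero_of_nontrivial V ht g hg, chi, dif_neg hg, mul_zero]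

lemma count_big (h2 : (2 : 𝔽) ≠ 0) (hev : Even (Bᵀ - B).rank)
    (hne : Fintype.card 𝔽 ^ ((Bᵀ - B).rank / 2) ≠ 1) :
    Nat.card {f : Hei 𝔽 n B → ℂ //
        ∃ V : FDRep ℂ (Hei 𝔽 n B), Simple V ∧
          Module.finrank ℂ V = Fintype.card 𝔽 ^ ((Bᵀ - B).rank / 2) ∧
          f = V.character} =
      (Fintype.card 𝔽 - 1) * Fintype.card 𝔽 ^ (n - (Bᵀ - B).rank) := by
  classical
  have hq : 0 < Fintype.card 𝔽 := Fintype.card_pos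
  have e1 : Nat.card {ψ : AddChar 𝔽 ℂ // ψ ≠ 1} = Fintype.card 𝔽 - 1 := by
    rw [Nat.card_eq_fintype_card, Fintype.card_subtype_compl, AddChar.card_eq,
      Fintype.card_subtype_eq]
  have e2 : Nat.card (AddChar (rad B) ℂ) = Fintype.card 𝔽 ^ (n - (Bᵀ - B).rank) := by
    rw [← card_rad, Nat.card_eq_fintype_card, Nat.card_eq_fintype_card, AddChar.card_eq]
  rw [← e1, ← e2, ← Nat.card_prod]
  symm
  refine Nat.card_congr (Equiv.ofBijective (fun x =>
    ⟨fun g => (Fintype.card 𝔽 ^ ((Bᵀ - B).rank / 2) : ℕ) * chi B x.1.1 x.2 g, ?_⟩) ⟨?_, ?_⟩)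
  · exact exists_rep x.1.1 x.2 h2 hev x.1.2
  · rintro ⟨⟨ψ, hψ⟩, θ⟩ ⟨⟨ψ', hψ'⟩, θ'⟩ h
    have h' := congrArg Subtype.val h
    have : chi B ψ θ = chi B ψ' θ' := by
      funext g
      have := congrFun h' g
      refine mul_left_cancel₀ ?_ this
      exact_mod_cast (pow_pos hq _).ne'
    obtain ⟨rfl, rfl⟩ := chi_inj h2 this
    rfl
  · rintro ⟨f, V, hV, hd, rfl⟩
    obtain ⟨ψ, hψ, θ, hθ⟩ := exists_chi h2 V (by rw [hd]; exact hne)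
    refine ⟨(⟨ψ, hψ⟩, θ), Subtype.ext ?_⟩
    rw [hd] at hθ
    exact hθ

end Hei

/-- Assume `m := rank(Bᵀ − B) > 0`.  Then `m` is even, every irreducible complex
representation of `H_β` has dimension `1` or `q^{m/2}`, exactly `qⁿ` of them (up to
isomorphism, equivalently counted by their characters) have dimension `1`, and exactly
`(q−1)·q^{n−m}` of them have dimension `q^{m/2}`. -/
theorem stmt_8 (q p k : ℕ) (hp : p.Prime) (hodd : Odd p) (hk : 0 < k) (hq : q = p ^ k)
    (𝔽 : Type) [Field 𝔽] [Fintype 𝔽] (hcard : Fintype.card 𝔽 = q)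
    (n : ℕ) (hn : 0 < n) (B : Matrix (Fin n) (Fin n) 𝔽)
    (m : ℕ) (hm : m = (Bᵀ - B).rank) (hmpos : 0 < m) :
    Even m ∧
    (∀ V : FDRep ℂ (Hei 𝔽 n B), Simple V →
      Module.finrank ℂ V = 1 ∨ Module.finrank ℂ V = q ^ (m / 2)) ∧
    Nat.card {f : Hei 𝔽 n B → ℂ //
        ∃ V : FDRep ℂ (Hei 𝔽 n B), Simple V ∧ Module.finrank ℂ V = 1 ∧
          f = V.character} = q ^ n ∧
    Nat.card {f : Hei 𝔽 n B → ℂ //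
        ∃ V : FDRep ℂ (Hei 𝔽 n B), Simple V ∧ Module.finrank ℂ V = q ^ (m / 2) ∧
          f = V.character} = (q - 1) * q ^ (n - m) := by
  subst hm hcard
  have h2 : (2 : 𝔽) ≠ 0 := by
    intro h
    have hdvd : (ringChar 𝔽) ∣ 2 := (ringChar.spec 𝔽 2).1 (by exact_mod_cast h)
    have hch : ringChar 𝔽 = 2 := by
      rcases (Nat.dvd_prime Nat.prime_two).1 hdvd with h1 | h1
      · exact absurd h1 (CharP.ringChar_ne_one)
      · exact h1
    have hE := FiniteField.even_card_of_char_two hch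
    rw [hq] at hE
    have hO := Nat.odd_iff.1 (hodd.pow (n := k))
    omega
  have hev : Even (Bᵀ - B).rank := Hei_even h2 _ (by simp)
  have hne : Fintype.card 𝔽 ^ ((Bᵀ - B).rank / 2) ≠ 1 := by
    have h1 : 1 < Fintype.card 𝔽 := Fintype.one_lt_card
    obtain ⟨l, hl⟩ := hev
    exact (Nat.one_lt_pow (by omega) h1).ne'
  refine ⟨hev, fun V hV => ?_, Hei.count_one hmpos, Hei.count_big h2 hev hne⟩
  by_cases h : ∀ t, V.ρ ⟨0, t⟩ = 1
  · exact Or.inl (Hei.finrank_one_of_trivial V h)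
  · push Not at h
    obtain ⟨t, ht⟩ := h
    exact Or.inr (Hei.finrank_of_nontrivial hev V ht)
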